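/- Let p, q ≥ 1 be reals, let m ≥ 1, and let g be a standard Gaussian random vector in ℝ^m. Then E[ ∫_{S^{m−1}} ∫_{S^{m−1}} |⟨g,u⟩|^p · |⟨g,v⟩|^q σ(du) σ(dv) ] = 2^{(p+q)/2 + 1} Γ((m+p+q)/2) Γ((1+p)/2) Γ((1+q)/2) Γ(1 + m/2) / ( m π Γ((m+p)/2) Γ((m+q)/2) ). -/

import Mathlib

open MeasureTheory ProbabilityTheory Real

lemma aux_pi_gauss (m : ℕ) : (Measure.pi fun _ : Fin m => gaussianReal 0 1) =
    (volume : Measure (Fin m → ℝ)).withDensity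
      (fun x => ENNReal.ofReal (∏ i, gaussianPDFReal 0 1 (x i))) := by
  apply Measure.pi_eq
  intro s hs
  rw [withDensity_apply _ (MeasurableSet.univ_pi hs), volume_pi, Measure.restrict_pi_pi,
    ← ofReal_integral_eq_lintegral_ofReal]
  · rw [integral_fintype_prod_eq_prod (f := fun _ : Fin m => gaussianPDFReal 0 1),
      ENNReal.ofReal_prod_of_nonneg]
    · refine Finset.prod_congr rfl fun i _ => ?_
      rw [gaussianReal_apply_eq_integral _ one_ne_zero]
    · intro i _
      exact integral_nonneg fun x => gaussianPDFReal_nonneg _ _ _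
  · exact Integrable.fintype_prod (f := fun _ : Fin m => gaussianPDFReal 0 1)
      fun i => (integrable_gaussianPDFReal 0 1).restrict
  · exact ae_of_all _ fun x => Finset.prod_nonneg fun i _ => gaussianPDFReal_nonneg _ _ _

lemma aux_pdf_prod (m : ℕ) (x : Fin m → ℝ) : ∏ i, gaussianPDFReal 0 1 (x i) =
    ((√(2 * π))⁻¹) ^ m * exp (-(1 / 2) * ‖WithLp.toLp 2 x‖ ^ (2 : ℝ)) := by
  rw [rpow_two, EuclideanSpace.real_norm_sq_eq]
  simp only [gaussianPDFReal, Finset.prod_mul_distrib, ← Real.exp_sum]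
  simp only [NNReal.coe_one, mul_one, sub_zero, Finset.prod_const, Finset.card_univ,
    Fintype.card_fin, Finset.mul_sum]
  congr 2
  refine Finset.sum_congr rfl fun i _ => ?_
  ring

lemma aux_gauss_integral (m : ℕ) (F : EuclideanSpace ℝ (Fin m) → ℝ) :
    ∫ g : Fin m → ℝ, F (WithLp.toLp 2 g) ∂(Measure.pi fun _ : Fin m => gaussianReal 0 1) =
      ((√(2 * π))⁻¹) ^ m * ∫ x, F x * exp (-(1 / 2) * ‖x‖ ^ (2 : ℝ)) := by
  have hmeas : Measurable (fun x : Fin m → ℝ => ENNReal.ofReal (∏ i, gaussianPDFReal 0 1 (x i))) := by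
    have := measurable_gaussianPDFReal 0 1
    fun_prop
  rw [aux_pi_gauss, integral_withDensity_eq_integral_toReal_smul hmeas (by simp)]
  rw [← (PiLp.volume_preserving_toLp (Fin m)).integral_comp
    (MeasurableEquiv.toLp 2 _).measurableEmbedding, ← integral_const_mul]
  refine integral_congr_ae (ae_of_all _ fun x => ?_)
  dsimp only
  rw [ENNReal.toReal_ofReal (Finset.prod_nonneg fun i _ => gaussianPDFReal_nonneg _ _ _),
    aux_pdf_prod, smul_eq_mul]
  ring

lemma aux_polar (m : ℕ) (F : EuclideanSpace ℝ (Fin m) → ℝ) [NeZero m]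
    (f : Metric.sphere (0 : EuclideanSpace ℝ (Fin m)) 1 → ℝ) (h : ℝ → ℝ)
    (hF : ∀ (u : Metric.sphere (0 : EuclideanSpace ℝ (Fin m)) 1) (r : ℝ), 0 < r →
      F (r • (u : EuclideanSpace ℝ (Fin m))) = f u * h r) :
    ∫ x, F x = (∫ u, f u ∂(volume : Measure (EuclideanSpace ℝ (Fin m))).toSphere) *
      ∫ r in Set.Ioi (0 : ℝ), r ^ (m - 1) * h r := by
  set μ := (volume : Measure (EuclideanSpace ℝ (Fin m)))
  calc
    ∫ x, F x = ∫ x : ({(0)}ᶜ : Set (EuclideanSpace ℝ (Fin m))), F x.1 ∂(μ.comap (↑)) := by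
      rw [integral_subtype_comap (measurableSet_singleton _).compl fun x ↦ F x,
        restrict_compl_singleton]
    _ = ∫ z, f z.1 * h z.2 ∂μ.toSphere.prod (.volumeIoiPow
          (Module.finrank ℝ (EuclideanSpace ℝ (Fin m)) - 1)) := by
      rw [← μ.measurePreserving_homeomorphUnitSphereProd.integral_comp
        (Homeomorph.measurableEmbedding _)]
      refine integral_congr_ae (ae_of_all _ fun x => ?_)
      dsimp only
      rw [← hF _ _ (homeomorphUnitSphereProd _ x).2.2]
      congr 1
      have := (homeomorphUnitSphereProd (EuclideanSpace ℝ (Fin m))).symm_apply_apply x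
      conv_lhs => rw [← this]
      rfl
    _ = _ := by
      rw [integral_prod_mul (f := f) (g := fun r : Set.Ioi (0:ℝ) => h r), finrank_euclideanSpace_fin]
      congr 1
      simp only [Measure.volumeIoiPow, ENNReal.ofReal]
      rw [integral_withDensity_eq_integral_smul, 
        integral_subtype_comap measurableSet_Ioi fun a ↦ Real.toNNReal (a ^ (m - 1)) • h a,
        setIntegral_congr_fun measurableSet_Ioi fun x hx ↦ ?_]
      · rw [NNReal.smul_def, Real.coe_toNNReal _ (pow_nonneg hx.out.le _), smul_eq_mul]
      · exact (measurable_subtype_coe.pow_const _).real_toNNReal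

lemma aux_radial (m : ℕ) [NeZero m] (s : ℝ) (hs : 0 ≤ s) :
    ∫ r in Set.Ioi (0 : ℝ), r ^ (m - 1) * (r ^ s * exp (-(1 / 2) * r ^ (2 : ℝ))) =
      2 ^ (((m : ℝ) + s) / 2 - 1) * Real.Gamma (((m : ℝ) + s) / 2) := by
  have hm : (1 : ℝ) ≤ m := by exact_mod_cast NeZero.one_le
  have := integral_rpow_mul_exp_neg_mul_rpow (p := 2) (q := m - 1 + s) (b := 1 / 2)
    (by norm_num) (by linarith) (by norm_num)
  rw [show (m - 1 + s + 1 : ℝ) = m + s by ring] at this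
  rw [rpow_sub (by norm_num), rpow_one]
  convert this using 1
  · refine setIntegral_congr_fun measurableSet_Ioi fun x hx ↦ ?_
    rw [rpow_add hx, ← mul_assoc, ← Real.rpow_natCast, Nat.cast_sub NeZero.one_le, Nat.cast_one]
  · rw [one_div, inv_rpow (by norm_num), ← rpow_neg (by norm_num)]
    rw [show -(-((m:ℝ) + s) / 2) = (m + s) / 2 by ring]
    ring

lemma aux_moment (p : ℝ) (hp : 1 ≤ p) : ∫ x, |x| ^ p ∂(gaussianReal 0 1) =
    2 ^ (p / 2) * Real.Gamma ((1 + p) / 2) / √π := by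
  rw [integral_gaussianReal_eq_integral_smul one_ne_zero]
  have h := integral_comp_abs (f := fun x => x ^ p * exp (-(1 / 2) * x ^ (2 : ℝ)))
  have h2 := integral_rpow_mul_exp_neg_mul_rpow (p := 2) (q := p) (b := 1 / 2)
    (by norm_num) (by linarith) (by norm_num)
  rw [h2] at h
  have h3 : ∀ x : ℝ, gaussianPDFReal 0 1 x • |x| ^ p =
      (√(2 * π))⁻¹ * (|x| ^ p * exp (-(1 / 2) * |x| ^ (2 : ℝ))) := by
    intro x
    simp only [gaussianPDFReal, rpow_two, sq_abs, smul_eq_mul, NNReal.coe_one, mul_one, sub_zero]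
    rw [show -(1/2) * x^2 = -x^2/2 by ring]
    ring
  simp_rw [h3]
  rw [integral_const_mul, h, one_div, inv_rpow (by norm_num), ← rpow_neg (by norm_num),
    show -(-(p + 1) / 2) = p / 2 + 1 / 2 by ring, rpow_add (by norm_num), ← sqrt_eq_rpow,
    sqrt_mul (by norm_num), add_comm p 1]
  have : √2 ≠ 0 := by positivity
  field_simp

lemma aux_gauss_inner (m : ℕ) (a : EuclideanSpace ℝ (Fin m)) (p : ℝ) (hp : 1 ≤ p) :
    ∫ x, |inner ℝ a x| ^ p ∂(stdGaussian (EuclideanSpace ℝ (Fin m))) =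
      ‖a‖ ^ p * (2 ^ (p / 2) * Real.Gamma ((1 + p) / 2) / √π) := by
  have h1 := IsGaussian.map_eq_gaussianReal (μ := stdGaussian (EuclideanSpace ℝ (Fin m)))
    (innerSL ℝ a)
  rw [integral_strongDual_stdGaussian, variance_dual_stdGaussian, innerSL_apply_norm] at h1
  have h2 : (gaussianReal 0 1).map (fun x => ‖a‖ * x) = gaussianReal 0 (‖a‖ ^ 2).toNNReal := by
    rw [gaussianReal_map_const_mul]
    congr 1
    · simp
    · ext; simp
  have hmeas : Measurable (fun x : ℝ => |x| ^ p) := by fun_prop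
  have h3 : ∫ y, |y| ^ p ∂((stdGaussian (EuclideanSpace ℝ (Fin m))).map (innerSL ℝ a)) =
      ∫ x, |inner ℝ a x| ^ p ∂(stdGaussian (EuclideanSpace ℝ (Fin m))) := by
    rw [integral_map (by fun_prop) hmeas.aestronglyMeasurable]
    rfl
  rw [← h3, h1, ← h2, integral_map (by fun_prop) hmeas.aestronglyMeasurable, ← aux_moment p hp,
    ← integral_const_mul]
  refine integral_congr_ae (ae_of_all _ fun x => ?_)
  dsimp only
  rw [abs_mul, abs_norm, mul_rpow (by positivity) (by positivity)]

lemma aux_gauss_inner' (m : ℕ) (a : EuclideanSpace ℝ (Fin m)) (p : ℝ) (hp : 1 ≤ p) :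
    ((√(2 * π))⁻¹) ^ m * ∫ x, |inner ℝ a x| ^ p * exp (-(1 / 2) * ‖x‖ ^ (2 : ℝ)) =
      ‖a‖ ^ p * (2 ^ (p / 2) * Real.Gamma ((1 + p) / 2) / √π) := by
  rw [← aux_gauss_inner m a p hp, ← map_pi_eq_stdGaussian, integral_map (by fun_prop)]
  · rw [aux_gauss_integral m (fun x => |inner ℝ a x| ^ p)]
  · apply Measurable.aestronglyMeasurable
    fun_prop

lemma aux_sphere_inner (m : ℕ) [NeZero m] (a : EuclideanSpace ℝ (Fin m)) (p : ℝ) (hp : 1 ≤ p) :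
    ((√(2 * π))⁻¹) ^ m *
      ((∫ u : Metric.sphere (0 : EuclideanSpace ℝ (Fin m)) 1,
        |inner ℝ a (u : EuclideanSpace ℝ (Fin m))| ^ p
          ∂(volume : Measure (EuclideanSpace ℝ (Fin m))).toSphere) *
      (2 ^ (((m : ℝ) + p) / 2 - 1) * Real.Gamma (((m : ℝ) + p) / 2))) =
      ‖a‖ ^ p * (2 ^ (p / 2) * Real.Gamma ((1 + p) / 2) / √π) := by
  rw [← aux_gauss_inner' m a p hp, ← aux_radial m p (by linarith),
    aux_polar m (fun x => |inner ℝ a x| ^ p * exp (-(1 / 2) * ‖x‖ ^ (2 : ℝ)))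
      (fun u => |inner ℝ a (u : EuclideanSpace ℝ (Fin m))| ^ p)
      (fun r => r ^ p * exp (-(1 / 2) * r ^ (2 : ℝ)))]
  intro u r hr
  rw [inner_smul_right, abs_mul, mul_rpow (by positivity) (by positivity), abs_of_pos hr,
    norm_smul, norm_eq_of_mem_sphere, norm_of_nonneg hr.le]
  ring_nf

lemma aux_norm_moment (m : ℕ) [NeZero m] (s : ℝ) (hs : 0 ≤ s) :
    ∫ g : Fin m → ℝ, ‖WithLp.toLp 2 g‖ ^ s ∂(Measure.pi fun _ : Fin m => gaussianReal 0 1) =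
      ((√(2 * π))⁻¹) ^ m * ((volume : Measure (EuclideanSpace ℝ (Fin m))).toSphere.real Set.univ *
      (2 ^ (((m : ℝ) + s) / 2 - 1) * Real.Gamma (((m : ℝ) + s) / 2))) := by
  rw [aux_gauss_integral m (fun x => ‖x‖ ^ s), ← aux_radial m s hs,
    aux_polar m (fun x => ‖x‖ ^ s * exp (-(1 / 2) * ‖x‖ ^ (2 : ℝ)))
      (fun u => 1)
      (fun r => r ^ s * exp (-(1 / 2) * r ^ (2 : ℝ)))]
  · simp
  intro u r hr
  rw [norm_smul, norm_eq_of_mem_sphere, norm_of_nonneg hr.le]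
  ring_nf

/-- For reals `p, q ≥ 1`, `m ≥ 1`, a standard Gaussian vector `g` in `ℝ^m`
and the normalized surface measure `σ` on `S^{m−1}`,
`E[∫∫ |⟨g,u⟩|^p |⟨g,v⟩|^q dσ(u) dσ(v)]
  = 2^{(p+q)/2+1} Γ((m+p+q)/2) Γ((1+p)/2) Γ((1+q)/2) Γ(1+m/2) / (m π Γ((m+p)/2) Γ((m+q)/2))`. -/
theorem gaussian_double_sphere_integral (m : ℕ) (hm : 1 ≤ m) (p q : ℝ)
    (hp : 1 ≤ p) (hq : 1 ≤ q) :
    let σ : Measure (Metric.sphere (0 : EuclideanSpace ℝ (Fin m)) 1) :=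
      (((volume : Measure (EuclideanSpace ℝ (Fin m))).toSphere Set.univ)⁻¹ •
        (volume : Measure (EuclideanSpace ℝ (Fin m))).toSphere)
    ∫ g : Fin m → ℝ,
        (∫ u : Metric.sphere (0 : EuclideanSpace ℝ (Fin m)) 1,
          ∫ v : Metric.sphere (0 : EuclideanSpace ℝ (Fin m)) 1,
            |∑ i, g i * (u : EuclideanSpace ℝ (Fin m)) i| ^ p *
              |∑ i, g i * (v : EuclideanSpace ℝ (Fin m)) i| ^ q ∂σ ∂σ)
        ∂(Measure.pi fun _ : Fin m => gaussianReal 0 1) =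
      2 ^ ((p + q) / 2 + 1) * Real.Gamma (((m : ℝ) + p + q) / 2) *
          Real.Gamma ((1 + p) / 2) * Real.Gamma ((1 + q) / 2) * Real.Gamma (1 + (m : ℝ) / 2) /
        ((m : ℝ) * Real.pi * Real.Gamma (((m : ℝ) + p) / 2) * Real.Gamma (((m : ℝ) + q) / 2)) := by
  intro σ
  have : NeZero m := ⟨by omega⟩
  have hm0 : (0 : ℝ) < m := by exact_mod_cast hm
  set S := (volume : Measure (EuclideanSpace ℝ (Fin m))).toSphere with hS
  have hin : ∀ (g : Fin m → ℝ) (u : EuclideanSpace ℝ (Fin m)),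
      ∑ i, g i * u i = inner ℝ (WithLp.toLp 2 g) u := by
    intro g u
    simp [PiLp.inner_apply, mul_comm]
  simp_rw [hin]
  set c := ((√(2 * π))⁻¹) ^ m with hc
  have hcpos : 0 < c := by positivity
  set V := S.real Set.univ with hV
  have hone := aux_norm_moment m 0 le_rfl
  simp only [rpow_zero, integral_const, probReal_univ, smul_eq_mul, one_mul, add_zero] at hone
  rw [← hc, ← hS, ← hV] at hone
  have hV0 : V ≠ 0 := by
    intro h0
    rw [h0] at hone
    simp at hone
  have hpq := aux_norm_moment m (p + q) (by linarith)
  rw [← hc, ← hS, ← hV] at hpq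
  have hGp : 0 < Real.Gamma (((m : ℝ) + p) / 2) := Real.Gamma_pos_of_pos (by linarith)
  have hGq : 0 < Real.Gamma (((m : ℝ) + q) / 2) := Real.Gamma_pos_of_pos (by linarith)
  have hG0 : 0 < Real.Gamma ((m : ℝ) / 2) := Real.Gamma_pos_of_pos (by linarith)
  have key : ∀ (s : ℝ), 1 ≤ s → ∀ g : Fin m → ℝ,
      ∫ u : Metric.sphere (0 : EuclideanSpace ℝ (Fin m)) 1,
        |inner ℝ (WithLp.toLp 2 g) (u : EuclideanSpace ℝ (Fin m))| ^ s ∂σ =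
      (Real.Gamma ((m : ℝ) / 2) * Real.Gamma ((1 + s) / 2) /
        (√π * Real.Gamma (((m : ℝ) + s) / 2))) * ‖WithLp.toLp 2 g‖ ^ s := by
    intro s hs g
    have hGs : 0 < Real.Gamma (((m : ℝ) + s) / 2) := Real.Gamma_pos_of_pos (by linarith)
    have h1 := aux_sphere_inner m (WithLp.toLp 2 g) s hs
    rw [integral_smul_measure, ENNReal.toReal_inv, smul_eq_mul]
    change V⁻¹ * _ = _
    rw [← hc, ← hS] at h1
    set J := ∫ u : Metric.sphere (0 : EuclideanSpace ℝ (Fin m)) 1,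
        |inner ℝ (WithLp.toLp 2 g) (u : EuclideanSpace ℝ (Fin m))| ^ s ∂S
    have h2 : (2 : ℝ) ^ (((m : ℝ) + s) / 2 - 1) = 2 ^ ((m : ℝ) / 2 - 1) * 2 ^ (s / 2) := by
      rw [← rpow_add (by norm_num)]
      congr 1
      ring
    rw [h2] at h1
    have e1 : (0 : ℝ) < 2 ^ ((m : ℝ) / 2 - 1) := by positivity
    have e2 : (0 : ℝ) < 2 ^ (s / 2) := by positivity
    set A := (2 : ℝ) ^ ((m : ℝ) / 2 - 1)
    set B := (2 : ℝ) ^ (s / 2)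
    have hpi : 0 < √π := by positivity
    have h3 : J * (c * A * √π * Real.Gamma ((m + s) / 2)) =
        ‖WithLp.toLp 2 g‖ ^ s * Real.Gamma ((1 + s) / 2) := by
      field_simp at h1
      linear_combination h1
    have h4 : c * A * (V * Real.Gamma (m / 2)) = 1 := by linear_combination -hone
    have h5 : c * A = (V * Real.Gamma (m / 2))⁻¹ := eq_inv_of_mul_eq_one_left h4
    rw [h5] at h3
    field_simp at h3 ⊢
    linear_combination h3
  have step : ∀ g : Fin m → ℝ,
      ∫ u : Metric.sphere (0 : EuclideanSpace ℝ (Fin m)) 1,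
        ∫ v : Metric.sphere (0 : EuclideanSpace ℝ (Fin m)) 1,
          |inner ℝ (WithLp.toLp 2 g) (u : EuclideanSpace ℝ (Fin m))| ^ p *
          |inner ℝ (WithLp.toLp 2 g) (v : EuclideanSpace ℝ (Fin m))| ^ q ∂σ ∂σ =
      (Real.Gamma ((m : ℝ) / 2) * Real.Gamma ((1 + p) / 2) /
        (√π * Real.Gamma (((m : ℝ) + p) / 2))) *
      (Real.Gamma ((m : ℝ) / 2) * Real.Gamma ((1 + q) / 2) /
        (√π * Real.Gamma (((m : ℝ) + q) / 2))) * ‖WithLp.toLp 2 g‖ ^ (p + q) := by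
    intro g
    simp_rw [integral_const_mul, integral_mul_const]
    rw [key p hp g, key q hq g, rpow_add_of_nonneg (norm_nonneg _) (by linarith) (by linarith)]
    ring
  simp_rw [step]
  rw [integral_const_mul, hpq]
  have h2 : (2 : ℝ) ^ (((m : ℝ) + (p + q)) / 2 - 1) =
      2 ^ ((m : ℝ) / 2 - 1) * 2 ^ ((p + q) / 2) := by
    rw [← rpow_add (by norm_num)]
    congr 1
    ring
  have h4 : c * 2 ^ ((m : ℝ) / 2 - 1) * V = (Real.Gamma (m / 2))⁻¹ :=
    eq_inv_of_mul_eq_one_left (by linear_combination -hone)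
  have h6 : Real.Gamma (1 + (m : ℝ) / 2) = m / 2 * Real.Gamma (m / 2) := by
    rw [add_comm, Real.Gamma_add_one (by positivity)]
  have h7 : c * (V * (2 ^ (((m : ℝ) + (p + q)) / 2 - 1) * Real.Gamma (((m : ℝ) + (p + q)) / 2)))
      = (Real.Gamma (m / 2))⁻¹ * 2 ^ ((p + q) / 2) * Real.Gamma (((m : ℝ) + (p + q)) / 2) := by
    rw [← h4, h2]
    ring
  rw [h7, h6, rpow_add (by norm_num), rpow_one, ← add_assoc]
  have hpi : √π ^ 2 = π := sq_sqrt pi_pos.le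
  have hpi0 : 0 < √π := by positivity
  generalize √π = P at *
  rw [← hpi]
  field_simp
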